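/- arXiv:2002.04191 — 10 statements merged into one kernel-verified Lean document; each statement's English description precedes it below -/
import Mathlib

section
/- For every positive integer n and every real number θ, sin(nθ) = 2^(n−1) · ∏_{k=1}^{n} sin(kπ/n − θ). -/
open Real Finset

theorem IsPrimitiveRoot.prod_one_sub_pow_mul {R : Type*} [CommRing R] [IsDomain R] {n : ℕ} {ζ : R}
    (hζ : IsPrimitiveRoot ζ n) (hn : 0 < n) (α : R) :
    ∏ k ∈ range n, (1 - ζ ^ k * α) = 1 - α ^ n := by
  have h := congrArg (Polynomial.eval 1) (X_pow_sub_C_eq_prod hζ hn (rfl : α ^ n = α ^ n))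
  simpa [Polynomial.eval_prod] using h.symm

theorem Complex.sin_eq_exp_mul_one_sub (z : ℂ) :
    Complex.sin z = Complex.I / 2 * (Complex.exp (-(z * I)) * (1 - Complex.exp (2 * (z * I)))) := by
  have h : Complex.exp (-(z * I)) * Complex.exp (2 * (z * I)) = Complex.exp (z * I) := by
    rw [← Complex.exp_add]
    ring_nf
  rw [mul_sub, h, Complex.sin, neg_mul]
  ring

theorem sum_range_succ_mul_div (n : ℕ) (hn : 0 < n) (x : ℂ) :
    ∑ k ∈ range n, ((k + 1 : ℕ) : ℂ) * x / n = (n + 1) * (x / 2) := by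
  have hsum : ∀ m : ℕ, ∑ k ∈ range m, ((k + 1 : ℕ) : ℂ) = m * (m + 1) / 2 := by
    intro m
    induction m with
    | zero => simp
    | succ m ih =>
      rw [sum_range_succ, ih]
      push_cast
      ring
  have hn' : (n : ℂ) ≠ 0 := Nat.cast_ne_zero.mpr hn.ne'
  rw [← sum_div, ← sum_mul, hsum]
  field_simp

theorem Complex.sin_nat_mul_eq_prod (n : ℕ) (hn : 0 < n) (z : ℂ) :
    Complex.sin (n * z) =
      2 ^ (n - 1) * ∏ k ∈ range n, Complex.sin ((k + 1 : ℕ) * π / n - z) := by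
  have hζ := Complex.isPrimitiveRoot_exp n hn.ne'
  set ζ := Complex.exp (2 * π * I / n) with hζ_def
  have hexp (k : ℕ) : Complex.exp (2 * (((k + 1 : ℕ) * π / n - z) * I)) =
      ζ ^ k * (ζ * Complex.exp (-(2 * (z * I)))) := by
    rw [← mul_assoc (ζ ^ k), ← pow_succ, hζ_def, ← Complex.exp_nat_mul, ← Complex.exp_add]
    ring_nf
  have hα : (ζ * Complex.exp (-(2 * (z * I)))) ^ n = Complex.exp (-(2 * (n * z * I))) := by
    rw [mul_pow, hζ.pow_eq_one, one_mul, ← Complex.exp_nat_mul]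
    ring_nf
  have hphase : ∏ k ∈ range n, Complex.exp (-(((k + 1 : ℕ) * π / n - z) * I)) =
      (-I) ^ (n + 1) * Complex.exp (n * z * I) := by
    rw [← Complex.exp_sum, sum_neg_distrib, ← sum_mul, sum_sub_distrib,
      sum_range_succ_mul_div n hn, ← Complex.exp_neg_pi_div_two_mul_I, ← Complex.exp_nat_mul,
      ← Complex.exp_add]
    simp only [sum_const, card_range, nsmul_eq_mul]
    push_cast
    ring_nf
  have hI : (I / 2) ^ n * (-I) ^ (n + 1) * 2 ^ (n - 1) = -I / 2 := by
    obtain ⟨m, rfl⟩ : ∃ m, n = m + 1 := ⟨n - 1, by omega⟩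
    have h1 : I * (-I) = 1 := by simp
    calc (I / 2) ^ (m + 1) * (-I) ^ (m + 1 + 1) * 2 ^ (m + 1 - 1)
        = (I * (-I)) ^ (m + 1) * ((1 / 2) ^ m * 2 ^ m) * (-I / 2) := by
          rw [Nat.add_sub_cancel, div_pow, mul_pow, one_div, inv_pow]
          field_simp
          ring
      _ = -I / 2 := by rw [h1, ← mul_pow]; norm_num
  simp_rw [Complex.sin_eq_exp_mul_one_sub (_ - z), prod_mul_distrib, hexp]
  rw [hζ.prod_one_sub_pow_mul hn, hα, hphase, prod_const, card_range]
  have hcomb : Complex.exp (n * z * I) * (1 - Complex.exp (-(2 * (n * z * I)))) =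
      Complex.exp (n * z * I) - Complex.exp (-(n * z * I)) := by
    rw [mul_sub, mul_one, ← Complex.exp_add]
    ring_nf
  calc Complex.sin (n * z)
      = -I / 2 * (Complex.exp (n * z * I) - Complex.exp (-(n * z * I))) := by
        rw [Complex.sin, neg_mul]
        ring
    _ = _ := by
        rw [← hI, ← hcomb]
        ring

theorem sin_n_theta_prod (n : ℕ) (hn : 0 < n) (θ : ℝ) :
    Real.sin (n * θ) =
      2 ^ (n - 1) * ∏ k ∈ Finset.Icc 1 n, Real.sin (k * π / n - θ) := by
  have hreindex : ∏ k ∈ Finset.Icc 1 n, Real.sin (k * π / n - θ) =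
      ∏ k ∈ range n, Real.sin ((k + 1 : ℕ) * π / n - θ) := by
    rw [← Finset.Ico_add_one_right_eq_Icc, prod_Ico_eq_prod_range]
    simp [add_comm]
  rw [hreindex]
  exact_mod_cast Complex.sin_nat_mul_eq_prod n hn θ
end

section
/- For every positive integer n and all real numbers x and y, ∏_{k=1}^{n} (x·sin(kπ/n) − y·cos(kπ/n)) = 2^(1−n) · ∑_{1 ≤ k ≤ n, k odd} (−1)^((k−1)/2) · C(n,k) · x^(n−k) · y^k, where C(n,k) is the binomial coefficient. -/
open Real Finset

theorem IsPrimitiveRoot.pow_sub_pow_eq_prod_Icc {R : Type*} [CommRing R] [IsDomain R]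
    {ζ : R} {n : ℕ} (hn : 0 < n) (h : IsPrimitiveRoot ζ n) (x y : R) :
    x ^ n - y ^ n = ∏ k ∈ Finset.Icc 1 n, (x - ζ ^ k * y) := by
  rw [h.pow_sub_pow_eq_prod_sub_mul x y hn]
  symm
  refine Finset.prod_nbij (fun k => ζ ^ k) ?_ ?_ ?_ (fun _ _ => rfl)
  · intro k _
    rw [Polynomial.mem_nthRootsFinset hn, ← pow_mul, mul_comm, pow_mul, h.pow_eq_one, one_pow]
  · intro i hi j hj hij
    simp only [Finset.coe_Icc, Set.mem_Icc] at hi hj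
    obtain ⟨i, rfl⟩ := Nat.exists_eq_add_of_le' hi.1
    obtain ⟨j, rfl⟩ := Nat.exists_eq_add_of_le' hj.1
    have hij' : ζ ^ i = ζ ^ j :=
      mul_right_cancel₀ (h.ne_zero hn.ne') (by simpa only [pow_succ] using hij)
    rw [h.pow_inj (by lia) (by lia) hij']
  · intro ξ hξ
    rw [Finset.mem_coe, Polynomial.mem_nthRootsFinset hn] at hξ
    have : NeZero n := ⟨hn.ne'⟩
    obtain ⟨i, hi, rfl⟩ := h.eq_pow_of_pow_eq_one hξ
    rcases Nat.eq_zero_or_pos i with rfl | hi0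
    · exact ⟨n, by simp only [Finset.coe_Icc, Set.mem_Icc]; lia, by simp [h.pow_eq_one]⟩
    · exact ⟨i, by simp only [Finset.coe_Icc, Set.mem_Icc]; lia, rfl⟩

theorem Complex.im_add_mul_I_pow (n : ℕ) (x y : ℝ) :
    (((x : ℂ) + y * Complex.I) ^ n).im =
      ∑ k ∈ (Finset.Icc 1 n).filter (fun k => Odd k),
        (-1 : ℝ) ^ ((k - 1) / 2) * (n.choose k) * x ^ (n - k) * y ^ k := by
  have hsub : (Finset.Icc 1 n).filter (fun k => Odd k) =
      (Finset.range (n + 1)).filter (fun k => Odd k) := by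
    ext k
    simp only [Finset.mem_filter, Finset.mem_Icc, Finset.mem_range]
    constructor
    · rintro ⟨h, ho⟩
      exact ⟨by lia, ho⟩
    · rintro ⟨h, ho⟩
      exact ⟨⟨ho.pos, by lia⟩, ho⟩
  rw [hsub, Finset.sum_filter, add_comm, add_pow, Complex.im_sum]
  refine Finset.sum_congr rfl fun k _ => ?_
  rcases Nat.even_or_odd' k with ⟨m, rfl | rfl⟩
  · rw [if_neg (by simp)]
    have : ((y : ℂ) * Complex.I) ^ (2 * m) * (x : ℂ) ^ (n - 2 * m) * (n.choose (2 * m) : ℂ) =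
        ((y ^ (2 * m) * (-1) ^ m * x ^ (n - 2 * m) * (n.choose (2 * m)) : ℝ) : ℂ) := by
      rw [mul_pow, pow_mul Complex.I, Complex.I_sq]
      push_cast
      ring
    rw [this, Complex.ofReal_im]
  · rw [if_pos ⟨m, rfl⟩]
    have : ((y : ℂ) * Complex.I) ^ (2 * m + 1) * (x : ℂ) ^ (n - (2 * m + 1)) *
          (n.choose (2 * m + 1) : ℂ) =
        (((-1) ^ m * (n.choose (2 * m + 1)) * x ^ (n - (2 * m + 1)) * y ^ (2 * m + 1) : ℝ) : ℂ) *
          Complex.I := by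
      rw [mul_pow, pow_succ Complex.I, pow_mul Complex.I, Complex.I_sq]
      push_cast
      ring
    rw [this, Complex.im_ofReal_mul, Complex.I_im, mul_one,
      show (2 * m + 1 - 1) / 2 = m by lia]

theorem Complex.prod_I_mul_exp_neg {n : ℕ} (hn : 0 < n) :
    ∏ k ∈ Finset.Icc 1 n, (Complex.I * Complex.exp (-(k * π / n * Complex.I))) = -Complex.I := by
  have hn' : (n : ℂ) ≠ 0 := Nat.cast_ne_zero.mpr hn.ne'
  have hsum (m : ℕ) : ∑ k ∈ Finset.Icc 1 m, (k : ℂ) = m * (m + 1) / 2 := by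
    induction m with
    | zero => simp
    | succ m ih =>
      rw [Finset.sum_Icc_succ_top (by lia), ih]
      push_cast
      ring
  have hI : Complex.exp (π / 2 * Complex.I) = Complex.I := Complex.exp_pi_div_two_mul_I
  calc ∏ k ∈ Finset.Icc 1 n, (Complex.I * Complex.exp (-(k * π / n * Complex.I)))
      = ∏ k ∈ Finset.Icc 1 n,
          Complex.exp (π / 2 * Complex.I - k * (π / n * Complex.I)) := by
        refine Finset.prod_congr rfl fun k _ => ?_
        rw [sub_eq_add_neg, Complex.exp_add, hI]
        congr 3
        ring
    _ = Complex.exp (-(π / 2 * Complex.I)) := by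
        rw [← Complex.exp_sum, Finset.sum_sub_distrib, Finset.sum_const, ← Finset.sum_mul, hsum]
        congr 1
        simp only [Nat.card_Icc, nsmul_eq_mul, Nat.add_sub_cancel]
        field_simp
        ring
    _ = -Complex.I := by rw [Complex.exp_neg, hI, Complex.inv_I]

theorem Complex.mul_sin_sub_mul_cos (x y θ : ℝ) :
    ((x * Real.sin θ - y * Real.cos θ : ℝ) : ℂ) =
      2⁻¹ * (Complex.I * Complex.exp (-(θ * Complex.I))) *
        ((x + y * Complex.I) - Complex.exp (2 * θ * Complex.I) * (x - y * Complex.I)) := by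
  have h : Complex.exp (2 * θ * Complex.I) =
      Complex.exp (θ * Complex.I) * Complex.exp (θ * Complex.I) := by
    rw [← Complex.exp_add]
    ring_nf
  have hinv : Complex.exp (-(θ * Complex.I)) * Complex.exp (θ * Complex.I) = 1 := by
    rw [← Complex.exp_add]
    simp
  push_cast
  rw [Complex.sin, Complex.cos, h, neg_mul]
  linear_combination (2⁻¹ * Complex.I * (x - y * Complex.I) * Complex.exp (θ * Complex.I)) * hinv
    + (2⁻¹ * y * (Complex.exp (-(θ * Complex.I)) + Complex.exp (θ * Complex.I))) *
      (-Complex.I_sq)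

theorem Fn_star_expansion (n : ℕ) (hn : 0 < n) (x y : ℝ) :
    ∏ k ∈ Finset.Icc 1 n, (x * Real.sin (k * π / n) - y * Real.cos (k * π / n)) =
      (2 : ℝ) ^ (1 - (n : ℤ)) *
        ∑ k ∈ (Finset.Icc 1 n).filter (fun k => Odd k),
          (-1 : ℝ) ^ ((k - 1) / 2) * (n.choose k) * x ^ (n - k) * y ^ k := by
  rw [← Complex.im_add_mul_I_pow]
  apply Complex.ofReal_injective
  set z : ℂ := x + y * Complex.I with hz
  have hconj : (starRingEnd ℂ) z = x - y * Complex.I := by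
    simp [hz, sub_eq_add_neg]
  have hroot := Complex.isPrimitiveRoot_exp n hn.ne'
  have hterm (k : ℕ) : ((x * Real.sin (k * π / n) - y * Real.cos (k * π / n) : ℝ) : ℂ) =
      2⁻¹ * (Complex.I * Complex.exp (-(k * π / n * Complex.I))) *
        (z - Complex.exp (2 * π * Complex.I / n) ^ k * (starRingEnd ℂ) z) := by
    rw [Complex.mul_sin_sub_mul_cos, hconj, ← Complex.exp_nat_mul]
    push_cast
    congr 4
    ring
  rw [Complex.ofReal_prod, Finset.prod_congr rfl fun k _ => hterm k, Finset.prod_mul_distrib,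
    Finset.prod_mul_distrib, ← hroot.pow_sub_pow_eq_prod_Icc hn, Complex.prod_I_mul_exp_neg hn,
    ← map_pow, Complex.sub_conj, zpow_sub₀ two_ne_zero]
  simp only [Finset.prod_const, Nat.card_Icc, Nat.add_sub_cancel, zpow_one, zpow_natCast]
  push_cast
  rw [inv_pow, div_eq_mul_inv]
  linear_combination (-2 * ((2 : ℂ) ^ n)⁻¹ * ((z ^ n).im : ℂ)) * Complex.I_sq
end

section
/- For every integer n ≥ 2 and every real number x, ∏_{k=1}^{n−1} (sin(kπ/n)·x − cos(kπ/n)) = 2^(1−n) · Im((x + i)^n), where Im denotes the imaginary part of a complex number and i is the imaginary unit. -/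
open Real Finset Complex

theorem prod_exp_mul_pi_div (m : ℕ) :
    ∏ j ∈ Finset.range m, Complex.exp (((j + 1 : ℕ) * π / (m + 1 : ℕ) : ℝ) * Complex.I) =
      Complex.I ^ m := by
  have hsum : ∑ j ∈ Finset.range m, ((j + 1 : ℕ) : ℂ) = m * (m + 1) / 2 := by
    induction m with
    | zero => simp
    | succ m ih => rw [Finset.sum_range_succ, ih]; push_cast; ring
  have hm : (m + 1 : ℂ) ≠ 0 := by exact_mod_cast m.succ_ne_zero
  rw [← Complex.exp_sum]
  have harg : ∑ j ∈ Finset.range m, (((j + 1 : ℕ) * π / (m + 1 : ℕ) : ℝ) : ℂ) * Complex.I =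
      m * (π / 2 * Complex.I) := by
    calc _ = (∑ j ∈ Finset.range m, ((j + 1 : ℕ) : ℂ)) * (π / (m + 1) * Complex.I) := by
          rw [Finset.sum_mul]
          refine Finset.sum_congr rfl fun j _ => ?_
          push_cast
          ring
      _ = _ := by rw [hsum]; field_simp
  rw [harg, Complex.exp_nat_mul, Complex.exp_pi_div_two_mul_I]

theorem add_I_sub_exp_sq_mul_sub_I (x θ : ℝ) :
    (x + Complex.I : ℂ) - Complex.exp (θ * Complex.I) ^ 2 * (x - Complex.I) =
      -2 * Complex.I * Complex.exp (θ * Complex.I) *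
        ((Real.sin θ * x - Real.cos θ : ℝ) : ℂ) := by
  have h : Complex.sin θ ^ 2 + Complex.cos θ ^ 2 = 1 := Complex.sin_sq_add_cos_sq θ
  rw [Complex.exp_mul_I]
  push_cast
  linear_combination (x + Complex.I) * (-h) +
    (Complex.sin θ ^ 2 * (x + Complex.I)) * Complex.I_sq

theorem fn_star_eq_hn_star (n : ℕ) (hn : 2 ≤ n) (x : ℝ) :
    ∏ k ∈ Finset.Icc 1 (n - 1), (Real.sin (k * π / n) * x - Real.cos (k * π / n)) =
      (2 : ℝ) ^ (1 - (n : ℤ)) * (((x : ℂ) + Complex.I) ^ n).im := by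
  obtain ⟨m, rfl⟩ : ∃ m, n = m + 1 := ⟨n - 1, by omega⟩
  have hIcc : Finset.Icc 1 (m + 1 - 1) = Finset.Ico 1 (m + 1) := rfl
  rw [hIcc, Finset.prod_Ico_eq_prod_range, Nat.add_sub_cancel]
  simp only [Nat.add_comm 1]
  set P := ∏ j ∈ Finset.range m, (Real.sin ((j + 1 : ℕ) * π / (m + 1 : ℕ)) * x -
    Real.cos ((j + 1 : ℕ) * π / (m + 1 : ℕ))) with hP
  set w : ℂ := x + Complex.I with hw
  have hconj : (starRingEnd ℂ) w = x - Complex.I := by simp [hw, sub_eq_add_neg]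
  have hfactor := congrArg (Polynomial.eval w) (X_pow_sub_C_eq_prod
    (Complex.isPrimitiveRoot_exp (m + 1) m.succ_ne_zero) m.succ_pos
    (rfl : (x - Complex.I : ℂ) ^ (m + 1) = _))
  have hterm (j : ℕ) : w - Complex.exp (2 * π * Complex.I / (m + 1 : ℕ)) ^ (j + 1) *
      (x - Complex.I) = -2 * Complex.I *
        Complex.exp (((j + 1 : ℕ) * π / (m + 1 : ℕ) : ℝ) * Complex.I) *
        ((Real.sin ((j + 1 : ℕ) * π / (m + 1 : ℕ)) * x -
          Real.cos ((j + 1 : ℕ) * π / (m + 1 : ℕ)) : ℝ) : ℂ) := by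
    rw [← add_I_sub_exp_sq_mul_sub_I, ← Complex.exp_nat_mul, ← Complex.exp_nat_mul]
    congr 3
    push_cast
    ring
  simp only [Polynomial.eval_sub, Polynomial.eval_pow, Polynomial.eval_X, Polynomial.eval_C,
    Polynomial.eval_prod] at hfactor
  rw [Finset.prod_range_succ', Finset.prod_congr rfl fun j _ => hterm j,
    Finset.prod_mul_distrib, Finset.prod_mul_distrib, prod_exp_mul_pi_div, Finset.prod_const,
    Finset.card_range, ← Complex.ofReal_prod, ← hP, ← mul_pow, ← hconj, ← map_pow,
    Complex.sub_conj, pow_zero, one_mul, Complex.sub_conj,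
    show -2 * Complex.I * Complex.I = 2 by linear_combination -2 * Complex.I_sq] at hfactor
  have him : (w ^ (m + 1)).im = 2 ^ m * P := by
    have hwim : w.im = 1 := by simp [hw]
    rw [hwim, ← mul_assoc] at hfactor
    have h : 2 * (w ^ (m + 1)).im = 2 ^ m * P * (2 * 1) := by
      exact_mod_cast mul_right_cancel₀ Complex.I_ne_zero hfactor
    linarith
  have hexp : (1 : ℤ) - (m + 1 : ℕ) = -(m : ℤ) := by push_cast; ring
  rw [him, hexp, zpow_neg, zpow_natCast, inv_mul_cancel_left₀ (by positivity)]
end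

section
/- For every integer n ≥ 2 and every integer k with 1 ≤ k ≤ n−1, the polynomial p(x) = 2^(1−n)·Im((x+i)^n) (equivalently, p(x) = 2^(1−n) · ∑_{1 ≤ j ≤ n, j odd} (−1)^((j−1)/2) · C(n,j) · x^(n−j)) satisfies p(cot(kπ/n)) = 0. -/
open Real Finset Complex

theorem im_cot_add_I_pow {θ : ℝ} (hθ : Real.sin θ ≠ 0) (n : ℕ) :
    ((((Real.cos θ / Real.sin θ : ℝ) : ℂ) + Complex.I) ^ n).im =
      Real.sin (n * θ) / Real.sin θ ^ n := by
  have hθ' : (Real.sin θ : ℂ) ≠ 0 := mod_cast hθ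
  have hbase : ((Real.cos θ / Real.sin θ : ℝ) : ℂ) + Complex.I =
      (Complex.cos θ + Complex.sin θ * Complex.I) / (Real.sin θ : ℂ) := by
    rw [← Complex.ofReal_cos, ← Complex.ofReal_sin]
    push_cast at hθ' ⊢
    field_simp
  have hpow : (((Real.cos θ / Real.sin θ : ℝ) : ℂ) + Complex.I) ^ n =
      ((Real.cos (n * θ) : ℂ) + (Real.sin (n * θ) : ℂ) * Complex.I) /
        ((Real.sin θ ^ n : ℝ) : ℂ) := by
    rw [hbase, div_pow, Complex.cos_add_sin_mul_I_pow]
    push_cast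
    rfl
  rw [hpow, Complex.div_ofReal_im, Complex.add_im, Complex.ofReal_im, Complex.im_ofReal_mul,
    Complex.I_im, mul_one, zero_add]

theorem hn_star_root (n : ℕ) (hn : 2 ≤ n) (k : ℕ) (hk1 : 1 ≤ k) (hk2 : k ≤ n - 1) :
    (2 : ℝ) ^ (1 - (n : ℤ)) *
      ((((Real.cos (k * π / n) / Real.sin (k * π / n) : ℝ) : ℂ) + Complex.I) ^ n).im = 0 := by
  have hn0 : (0 : ℝ) < n := by exact_mod_cast (by omega : 0 < n)
  have hk0 : (0 : ℝ) < k := by exact_mod_cast hk1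
  have hkn : (k : ℝ) < n := by exact_mod_cast (by omega : k < n)
  have hsin : Real.sin (k * π / n) ≠ 0 := by
    refine (Real.sin_pos_of_pos_of_lt_pi (by positivity) ?_).ne'
    rw [div_lt_iff₀ hn0, mul_comm π]
    exact mul_lt_mul_of_pos_right hkn Real.pi_pos
  rw [im_cot_add_I_pow hsin, mul_div_cancel₀ _ hn0.ne', Real.sin_nat_mul_pi, zero_div, mul_zero]
end

section
/- For every positive integer n, the greatest common divisor g(n) of the binomial coefficients C(n,k) taken over all odd integers k with 1 ≤ k ≤ n equals 2^(ν₂(n)), where ν₂(n) is the 2-adic valuation of n (the exponent of the largest power of 2 dividing n). -/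
open Finset

theorem Nat.dvd_choose_of_coprime {d n k : ℕ} (hk : 0 < k) (hdn : d ∣ n) (hdk : d.Coprime k) :
    d ∣ n.choose k := by
  obtain ⟨j, rfl⟩ := Nat.exists_eq_add_of_lt hk
  rcases n with _ | m
  · simp
  · refine hdk.dvd_of_dvd_mul_right ?_
    rw [zero_add, ← Nat.add_one_mul_choose_eq]
    exact hdn.mul_right _

theorem Nat.dvd_two_pow_of_dvd_choose_odd {d n : ℕ} (hn : n ≠ 0)
    (hd : ∀ k, Odd k → d ∣ n.choose k) : d ∣ 2 ^ n := by
  have key : ∑ k ∈ range (n + 1), ((n.choose k : ℤ) - (-1) ^ k * n.choose k) = 2 ^ n := by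
    rw [sum_sub_distrib, Int.alternating_sum_range_choose_of_ne hn, sub_zero]
    exact_mod_cast Nat.sum_range_choose n
  have hdvd : (d : ℤ) ∣ 2 ^ n := by
    rw [← key]
    refine dvd_sum fun k _ => ?_
    rcases k.even_or_odd with hk | hk
    · simp [hk.neg_one_pow]
    · have h : (d : ℤ) ∣ n.choose k := Int.natCast_dvd_natCast.2 (hd k hk)
      exact _root_.dvd_sub h (h.mul_left _)
  exact_mod_cast hdvd

theorem gcd_odd_binomials (n : ℕ) (hn : 0 < n) :
    ((Finset.Icc 1 n).filter (fun k => Odd k)).gcd (fun k => n.choose k) =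
      2 ^ (padicValNat 2 n) := by
  set g := ((Finset.Icc 1 n).filter (fun k => Odd k)).gcd (fun k => n.choose k) with hg
  have hdvd : ∀ k, Odd k → g ∣ n.choose k := by
    intro k hk
    rcases le_or_gt k n with hkn | hkn
    · exact Finset.gcd_dvd (mem_filter.2 ⟨mem_Icc.2 ⟨hk.pos, hkn⟩, hk⟩)
    · simp [Nat.choose_eq_zero_of_lt hkn]
  apply Nat.dvd_antisymm
  · obtain ⟨j, -, hj⟩ := (Nat.dvd_prime_pow Nat.prime_two).1
      (Nat.dvd_two_pow_of_dvd_choose_odd hn.ne' hdvd)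
    have hgn : g ∣ n := by simpa using hdvd 1 odd_one
    rw [hj] at hgn ⊢
    exact pow_dvd_pow 2 ((padicValNat_dvd_iff_le hn.ne').1 hgn)
  · refine Finset.dvd_gcd fun k hk => ?_
    have hk_odd := (mem_filter.1 hk).2
    exact Nat.dvd_choose_of_coprime hk_odd.pos pow_padicValNat_dvd
      (Nat.Coprime.pow_left _ hk_odd.coprime_two_left)
end

section
/- For every positive integer n, the greatest common divisor g(n) of the binomial coefficients C(n,k) over all odd k with 1 ≤ k ≤ n is a power of 2; that is, g(n) has no odd prime factors. -/
open Finset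

theorem gcd_odd_binomials_pow_two (n : ℕ) (hn : 0 < n) :
    ∃ s : ℕ, ((Finset.Icc 1 n).filter (fun k => Odd k)).gcd (fun k => n.choose k) = 2 ^ s := by
  set g := ((Finset.Icc 1 n).filter (fun k => Odd k)).gcd (fun k => n.choose k)
  have hsum : ∑ k ∈ range (n + 1), (1 - (-1) ^ k) * (n.choose k : ℤ) = 2 ^ n := by
    have htotal : ∑ k ∈ range (n + 1), (n.choose k : ℤ) = 2 ^ n := by
      exact_mod_cast Nat.sum_range_choose n
    have halternating := Int.alternating_sum_range_choose_of_ne hn.ne'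
    simp only [sub_mul, one_mul, sum_sub_distrib, htotal, halternating, sub_zero]
  have hdvd : (g : ℤ) ∣ 2 ^ n := by
    rw [← hsum]
    refine dvd_sum fun k hk => ?_
    rcases Nat.even_or_odd k with heven | hodd
    · simp [heven.neg_one_pow]
    · have hmem : k ∈ (Finset.Icc 1 n).filter (fun k => Odd k) :=
        mem_filter.mpr ⟨mem_Icc.mpr ⟨hodd.pos, Nat.lt_succ_iff.mp (mem_range.mp hk)⟩, hodd⟩
      exact (Int.natCast_dvd_natCast.mpr (Finset.gcd_dvd hmem)).mul_left _
  obtain ⟨s, -, hs⟩ := (Nat.dvd_prime_pow Nat.prime_two).mp (by exact_mod_cast hdvd : g ∣ 2 ^ n)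
  exact ⟨s, hs⟩
end

section
/- For all positive integers n and k with 1 ≤ k ≤ n, the integer n / gcd(n,k) divides the binomial coefficient C(n,k). -/
theorem div_gcd_dvd_choose (n k : ℕ) (hk1 : 1 ≤ k) (hk2 : k ≤ n) :
    (n / Nat.gcd n k) ∣ n.choose k := by
  have hg : 0 < Nat.gcd n k := Nat.gcd_pos_of_pos_right n hk1
  have hdvd : n ∣ n.choose k * k := by
    obtain ⟨m, rfl⟩ := Nat.exists_eq_add_of_le' (hk1.trans hk2)
    obtain ⟨j, rfl⟩ := Nat.exists_eq_add_of_le' hk1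
    exact ⟨m.choose j, (Nat.add_one_mul_choose_eq m j).symm⟩
  refine (Nat.coprime_div_gcd_div_gcd hg).dvd_of_dvd_mul_right ?_
  rw [← Nat.mul_div_assoc _ (Nat.gcd_dvd_right n k)]
  exact Nat.div_dvd_div (Nat.gcd_dvd_left n k) hdvd
end

section
/- For every positive integer n, the smallest positive integer ℓ such that the binary form ℓ · F_n*(X,Y) has all integer coefficients is ℓ_n = 2^(n − 1 − ν₂(n)); equivalently: every coefficient of 2^(n−1−ν₂(n)) · F_n* is an integer, and for every positive integer ℓ < 2^(n−1−ν₂(n)) some coefficient of ℓ · F_n* is not an integer. -/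
open Real Finset MvPolynomial

theorem prod_Icc_sub_pow_mul {R : Type*} [CommRing R] [IsDomain R] {n : ℕ} (hn : 0 < n) {ζ : R}
    (hζ : IsPrimitiveRoot ζ n) (x y : R) :
    ∏ k ∈ Icc 1 n, (x - ζ ^ k * y) = x ^ n - y ^ n := by
  have hmaps : Set.MapsTo (fun k => ζ ^ k) (Icc 1 n : Finset ℕ)
      (Polynomial.nthRootsFinset n (1 : R)) := by
    intro k _
    rw [mem_coe, Polynomial.mem_nthRootsFinset hn, ← pow_mul, mul_comm, pow_mul, hζ.pow_eq_one,
      one_pow]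
  have hinj : Set.InjOn (fun k => ζ ^ k) (Icc 1 n : Finset ℕ) := by
    intro i hi j hj hij
    rw [mem_coe, Finset.mem_Icc] at hi hj
    obtain ⟨i, rfl⟩ := Nat.exists_eq_add_of_le' hi.1
    obtain ⟨j, rfl⟩ := Nat.exists_eq_add_of_le' hj.1
    have hij' : ζ ^ i = ζ ^ j :=
      mul_right_cancel₀ (hζ.ne_zero hn.ne') (by simpa only [pow_succ] using hij)
    rw [hζ.pow_inj (by omega) (by omega) hij']
  have hsurj := surjOn_of_injOn_of_card_le _ hmaps hinj (by simp [hζ.card_nthRootsFinset])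
  rw [hζ.pow_sub_pow_eq_prod_sub_mul x y hn]
  exact prod_nbij _ hmaps hinj hsurj fun _ _ => rfl

theorem prod_exp_mul_pi_mul_I_div {n : ℕ} (hn : 0 < n) :
    ∏ k ∈ Icc 1 n, Complex.exp (k * π / n * Complex.I) = Complex.I ^ (n + 1) := by
  have hn' : (n : ℂ) ≠ 0 := by exact_mod_cast hn.ne'
  have hsum : ∀ N : ℕ, ∑ k ∈ Icc 1 N, (k : ℂ) = N * (N + 1) / 2 := by
    intro N
    induction N with
    | zero => simp
    | succ N ih =>
      rw [sum_Icc_succ_top (by omega), ih]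
      push_cast
      ring
  have hI : Complex.I ^ (n + 1) = Complex.exp ((n + 1 : ℕ) * (π / 2 * Complex.I)) := by
    rw [Complex.exp_nat_mul, Complex.exp_pi_div_two_mul_I]
  rw [← Complex.exp_sum, hI, ← sum_mul, ← sum_div, ← sum_mul, hsum]
  congr 1
  push_cast
  field_simp

theorem coeff_X_add_C_mul_X_pow (a : ℂ) (n : ℕ) (m : Fin 2 →₀ ℕ) :
    coeff m ((X 0 + C a * X 1 : MvPolynomial (Fin 2) ℂ) ^ n) =
      if m 0 + m 1 = n then a ^ m 1 * (n.choose (m 1) : ℂ) else 0 := by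
  have h : ∀ i j, (X 0 ^ i * (C a * X 1) ^ j * (n.choose j : MvPolynomial (Fin 2) ℂ)) =
      monomial (Finsupp.single 0 i + Finsupp.single 1 j) (a ^ j * n.choose j : ℂ) := by
    intro i j
    rw [mul_pow, ← C_pow, X_pow_eq_monomial, X_pow_eq_monomial, C_mul_monomial, monomial_mul,
      ← map_natCast (C : ℂ →+* MvPolynomial (Fin 2) ℂ), mul_comm, C_mul_monomial]
    congr 1; ring
  have hm : ∀ i j, Finsupp.single 0 i + Finsupp.single 1 j = m ↔ m 0 = i ∧ m 1 = j := by
    intro i j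
    rw [Finsupp.ext_iff, Fin.forall_fin_two]
    simp [eq_comm]
  rw [add_comm, add_pow, coeff_sum]
  simp_rw [mul_comm ((C a * X 1 : MvPolynomial (Fin 2) ℂ) ^ _), h, coeff_monomial, hm]
  split_ifs with hmn
  · rw [Finset.sum_eq_single (m 1)]
    · rw [if_pos (by omega)]
    · intro b _ hb
      rw [if_neg (by tauto)]
    · simp; omega
  · refine Finset.sum_eq_zero fun j hj => if_neg ?_
    simp at hj
    omega

theorem C_mul_map_prod_sin_sub_cos_eq (n : ℕ) (hn : 0 < n) :
    C (2 ^ n * Complex.I) * MvPolynomial.map Complex.ofRealHom (∏ k ∈ Finset.Icc 1 n,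
      (C (Real.sin (k * π / n)) * X 0 - C (Real.cos (k * π / n)) * X 1)) =
    ((X 0 + C Complex.I * X 1) ^ n - (X 0 + C (-Complex.I) * X 1) ^ n :
      MvPolynomial (Fin 2) ℂ) := by
  have hζ : IsPrimitiveRoot (C (Complex.exp (2 * π * Complex.I / n)) : MvPolynomial (Fin 2) ℂ) n :=
    (Complex.isPrimitiveRoot_exp n hn.ne').map_of_injective (C_injective _ _)
  have hterm : ∀ k : ℕ, (X 0 + C Complex.I * X 1 : MvPolynomial (Fin 2) ℂ) -
      C (Complex.exp (2 * π * Complex.I / n)) ^ k * (X 0 + C (-Complex.I) * X 1) =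
      C (-2 * Complex.I * Complex.exp (k * π / n * Complex.I)) *
        MvPolynomial.map Complex.ofRealHom
          (C (Real.sin (k * π / n)) * X 0 - C (Real.cos (k * π / n)) * X 1) := by
    intro k
    have hexp : Complex.exp (2 * π * Complex.I / n) ^ k =
        Complex.exp (k * π / n * Complex.I) ^ 2 := by
      rw [← Complex.exp_nat_mul, ← Complex.exp_nat_mul]
      congr 1
      push_cast
      ring
    have hsq := Complex.sin_sq_add_cos_sq (k * π / n)
    have hI := Complex.I_sq
    rw [← C_pow, hexp, Complex.exp_mul_I]
    simp only [map_sub, map_mul, map_C, map_X, Complex.ofRealHom_eq_coe, Complex.ofReal_sin,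
      Complex.ofReal_cos, Complex.ofReal_div, Complex.ofReal_mul, Complex.ofReal_natCast]
    generalize Complex.sin (k * π / n) = s at *
    generalize Complex.cos (k * π / n) = c at *
    have h0 : 1 - (c + s * Complex.I) ^ 2 = -2 * Complex.I * (c + s * Complex.I) * s := by
      linear_combination -hsq + s ^ 2 * hI
    have h1 : Complex.I + (c + s * Complex.I) ^ 2 * Complex.I =
        2 * Complex.I * (c + s * Complex.I) * c := by
      linear_combination -Complex.I * hsq + s ^ 2 * Complex.I * hI
    have h0' := congrArg (C : ℂ → MvPolynomial (Fin 2) ℂ) h0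
    have h1' := congrArg (C : ℂ → MvPolynomial (Fin 2) ℂ) h1
    simp only [map_add, map_sub, map_mul, map_pow, map_neg, map_one] at h0' h1' ⊢
    linear_combination X 0 * h0' + X 1 * h1'
  rw [← prod_Icc_sub_pow_mul hn hζ, prod_congr rfl fun k _ => hterm k, prod_mul_distrib,
    ← map_prod, ← map_prod, prod_mul_distrib, prod_exp_mul_pi_mul_I_div hn, prod_const,
    Nat.card_Icc, Nat.add_sub_cancel]
  congr 2
  rw [pow_succ, ← mul_assoc, ← mul_pow, mul_assoc, Complex.I_mul_I]
  norm_num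

theorem coeff_prod_sin_sub_cos (n : ℕ) (hn : 0 < n) (m : Fin 2 →₀ ℕ) :
    coeff m (∏ k ∈ Finset.Icc 1 n,
      (C (Real.sin (k * π / n)) * X 0 - C (Real.cos (k * π / n)) * X 1)) =
    if m 0 + m 1 = n ∧ Odd (m 1) then (-1) ^ (m 1 / 2) * (n.choose (m 1) : ℝ) / 2 ^ (n - 1)
    else 0 := by
  have h := congrArg (coeff m) (C_mul_map_prod_sin_sub_cos_eq n hn)
  rw [coeff_C_mul, coeff_map, coeff_sub, coeff_X_add_C_mul_X_pow, coeff_X_add_C_mul_X_pow] at h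
  have h2 : (2 ^ n * Complex.I) ≠ 0 := by simp
  have h3 : (2:ℂ) ^ n = 2 ^ (n - 1) * 2 := by rw [← pow_succ, Nat.sub_add_cancel hn]
  rw [← Complex.ofReal_inj]
  apply mul_left_cancel₀ h2
  refine h.trans ?_
  by_cases hmn : m 0 + m 1 = n
  · obtain ⟨j, hj | hj⟩ := Nat.even_or_odd' (m 1)
    · simp [hj, (even_two_mul j).neg_pow]
    · have hdiv : (2 * j + 1) / 2 = j := by omega
      have hodd := odd_two_mul_add_one j
      rw [if_pos hmn, if_pos hmn, hj, if_pos ⟨hj ▸ hmn, hodd⟩, hodd.neg_pow, pow_succ, pow_mul,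
        Complex.I_sq, hdiv, h3]
      push_cast
      field_simp
      ring
  · simp [hmn]

theorem two_pow_padicValNat_dvd_choose {n k : ℕ} (hk : Odd k) :
    2 ^ padicValNat 2 n ∣ n.choose k := by
  obtain ⟨j, rfl⟩ := hk
  rcases n with _ | n
  · simp
  have h := Nat.add_one_mul_choose_eq n (2 * j)
  refine Nat.Coprime.dvd_of_dvd_mul_right (n := 2 * j + 1) ?_
    (h ▸ pow_padicValNat_dvd.mul_right _)
  exact Nat.Coprime.pow_left _ (by simp)

theorem least_integer_multiplier (n : ℕ) (hn : 0 < n) :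
    IsLeast
      {ℓ : ℕ | 0 < ℓ ∧
        ∀ m : Fin 2 →₀ ℕ,
          ∃ z : ℤ,
            MvPolynomial.coeff m
              ((ℓ : ℝ) •
                ∏ k ∈ Finset.Icc 1 n,
                  (MvPolynomial.C (Real.sin (k * π / n)) * MvPolynomial.X 0 -
                    MvPolynomial.C (Real.cos (k * π / n)) * MvPolynomial.X 1)) = (z : ℝ)}
      (2 ^ (n - 1 - padicValNat 2 n)) := by
  have hlt : padicValNat 2 n ≤ n - 1 := by
    have h1 := Nat.le_of_dvd hn (pow_padicValNat_dvd (p := 2) (n := n))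
    have h2 := Nat.lt_two_pow_self (n := padicValNat 2 n)
    omega
  have hpow : 2 ^ (n - 1) = 2 ^ (n - 1 - padicValNat 2 n) * 2 ^ padicValNat 2 n := by
    rw [← pow_add, Nat.sub_add_cancel hlt]
  refine ⟨⟨by positivity, fun m => ?_⟩, ?_⟩
  · rw [coeff_smul, coeff_prod_sin_sub_cos n hn, smul_eq_mul]
    split_ifs with h
    · obtain ⟨c, hc⟩ := two_pow_padicValNat_dvd_choose (n := n) h.2
      have hpow' : (2 : ℝ) ^ (n - 1) =
          2 ^ (n - 1 - padicValNat 2 n) * 2 ^ padicValNat 2 n := by exact_mod_cast hpow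
      refine ⟨(-1) ^ (m 1 / 2) * c, ?_⟩
      rw [hc, hpow']
      push_cast
      field_simp
    · exact ⟨0, by simp⟩
  · rintro ℓ ⟨hℓ, h⟩
    obtain ⟨z, hz⟩ := h (Finsupp.single 0 (n - 1) + Finsupp.single 1 1)
    rw [coeff_smul, coeff_prod_sin_sub_cos n hn, smul_eq_mul, if_pos (by simp; omega)] at hz
    simp at hz
    have hz' : (ℓ * n : ℤ) = 2 ^ (n - 1) * z := by
      field_simp at hz
      exact_mod_cast hz
    have hdvd : 2 ^ (n - 1) ∣ ℓ * n := by
      exact_mod_cast (Dvd.intro z hz'.symm : (2 : ℤ) ^ (n - 1) ∣ ℓ * n)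
    have hval := (padicValNat_dvd_iff_le (p := 2) (by positivity : ℓ * n ≠ 0)).1 hdvd
    rw [padicValNat.mul hℓ.ne' hn.ne'] at hval
    refine (Nat.pow_le_pow_right two_pos (by omega)).trans
      (Nat.le_of_dvd hℓ (pow_padicValNat_dvd (p := 2)))
end

section
/- For every integer n ≥ 3, the area (two-dimensional Lebesgue measure) of the region { (x,y) ∈ ℝ² : |F_n*(x,y)| ≤ 1 } equals 4^(1 − 1/n) · B(1/2 − 1/n, 1/2), where B is the Euler beta function. -/
open Real Finset MeasureTheory

/-- The product formula for the sine function, up to sign. -/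
lemma abs_prod_sin_sub (n : ℕ) (hn : 0 < n) (θ : ℝ) :
    |∏ k ∈ Finset.Icc 1 n, Real.sin (k * π / n - θ)| = 2 * |Real.sin (n * θ)| / 2 ^ n := by
  have hn' : (n : ℂ) ≠ 0 := by exact_mod_cast hn.ne'
  set ζ : ℂ := Complex.exp (2 * π * Complex.I / n) with hζ
  set w : ℂ := Complex.exp (Complex.I * ((-(2 * θ) : ℝ) : ℂ)) with hw
  have hprim : IsPrimitiveRoot ζ n := Complex.isPrimitiveRoot_exp n hn.ne'
  have hpoly := congrArg (Polynomial.eval 1)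
    (X_pow_sub_C_eq_prod hprim (α := ζ * w) (a := w ^ n) hn
      (by rw [mul_pow, hprim.pow_eq_one, one_mul]))
  simp only [Polynomial.eval_sub, Polynomial.eval_pow, Polynomial.eval_X, one_pow,
    Polynomial.eval_C, Polynomial.eval_prod] at hpoly
  have hnorm (x : ℝ) : ‖1 - Complex.exp (Complex.I * x)‖ = 2 * |Real.sin (x / 2)| := by
    rw [norm_sub_rev, Complex.norm_exp_I_mul_ofReal_sub_one]
    simp
  have hleft : ‖1 - w ^ n‖ = 2 * |Real.sin (n * θ)| := by
    rw [hw, ← Complex.exp_nat_mul,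
      show (n : ℂ) * (Complex.I * ((-(2 * θ) : ℝ) : ℂ)) =
        Complex.I * ((-(2 * (n * θ)) : ℝ) : ℂ) by push_cast; ring, hnorm,
      show -(2 * (n * θ)) / 2 = -(n * θ) by ring, Real.sin_neg, abs_neg]
  have hterm (i : ℕ) :
      ‖1 - ζ ^ i * (ζ * w)‖ = 2 * |Real.sin (((1 + i : ℕ) : ℝ) * π / n - θ)| := by
    rw [hζ, hw, ← Complex.exp_nat_mul, ← Complex.exp_add, ← Complex.exp_add,
      show (i : ℂ) * (2 * π * Complex.I / n) + (2 * π * Complex.I / n +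
          Complex.I * ((-(2 * θ) : ℝ) : ℂ)) =
        Complex.I * ((2 * (((1 + i : ℕ) : ℝ) * π / n - θ) : ℝ) : ℂ) by push_cast; ring, hnorm,
      mul_div_cancel_left₀ _ (two_ne_zero' ℝ)]
  have hmain := congrArg norm hpoly
  rw [norm_prod, hleft] at hmain
  simp only [hterm, Finset.prod_mul_distrib, Finset.prod_const, Finset.card_range] at hmain
  rw [hmain, mul_div_cancel_left₀ _ (by positivity), Finset.abs_prod,
    show Finset.Icc 1 n = Finset.Ico 1 (n + 1) by ext; simp,
    Finset.prod_Ico_eq_prod_range, Nat.add_sub_cancel]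

/-- The radial integral computing the area of a sector of a star-shaped region. -/
lemma lintegral_Ioi_radius (n : ℕ) (hn : 0 < n) (c : ℝ) (hc : 0 < c) :
    ∫⁻ r in Set.Ioi (0 : ℝ), ENNReal.ofReal r * {r : ℝ | r ^ n * c ≤ 1}.indicator 1 r =
      ENNReal.ofReal (c ^ (-(2 / n) : ℝ) / 2) := by
  have hn' : (n : ℝ) ≠ 0 := by exact_mod_cast hn.ne'
  set R : ℝ := c ^ (-(1 / n) : ℝ) with hR
  have hR0 : 0 < R := Real.rpow_pos_of_pos hc _
  have hRn : R ^ n = c⁻¹ := by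
    rw [hR, ← Real.rpow_mul_natCast hc.le, ← Real.rpow_neg_one]
    congr 1
    field_simp
  have hR2 : R ^ 2 = c ^ (-(2 / n) : ℝ) := by
    rw [hR, ← Real.rpow_mul_natCast hc.le]
    congr 1
    push_cast
    ring
  have hset : ∀ r ∈ Set.Ioi (0 : ℝ),
      ENNReal.ofReal r * {r : ℝ | r ^ n * c ≤ 1}.indicator 1 r =
        (Set.Iic R).indicator (fun r => ENNReal.ofReal r) r := by
    intro r hr
    have : r ^ n * c ≤ 1 ↔ r ≤ R := by
      rw [← pow_le_pow_iff_left₀ (le_of_lt hr) hR0.le hn.ne', hRn, ← le_div_iff₀ hc, one_div]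
    simp only [Set.indicator_apply, Set.mem_ofPred_eq, this, Set.mem_Iic]
    split_ifs <;> simp
  rw [setLIntegral_congr_fun measurableSet_Ioi hset, lintegral_indicator measurableSet_Iic,
    Measure.restrict_restrict measurableSet_Iic, Set.Iic_inter_Ioi,
    ← ofReal_integral_eq_lintegral_ofReal, ← intervalIntegral.integral_of_le hR0.le,
    integral_id, hR2]
  · simp
  · exact (intervalIntegrable_iff_integrableOn_Ioc_of_le hR0.le).1
      (intervalIntegral.intervalIntegrable_id)
  · exact ae_restrict_of_forall_mem measurableSet_Ioc fun r hr => hr.1.le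

/-- The trigonometric form of the beta integral. -/
lemma lintegral_sin_rpow_mul_cos_rpow (a b : ℝ) (ha : 0 < a) (hb : 0 < b) :
    ∫⁻ θ in Set.Ioo 0 (π / 2),
        ENNReal.ofReal (Real.sin θ ^ (2 * a - 1) * Real.cos θ ^ (2 * b - 1)) =
      ENNReal.ofReal (ProbabilityTheory.beta a b / 2) := by
  have hB := ProbabilityTheory.beta_pos ha hb
  have hone := ProbabilityTheory.lintegral_betaPDF_eq_one ha hb
  have himage : (fun θ : ℝ => Real.sin θ ^ 2) '' Set.Ioo 0 (π / 2) = Set.Ioo 0 1 := by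
    ext x
    constructor
    · rintro ⟨θ, hθ, rfl⟩
      have hs : 0 < Real.sin θ := Real.sin_pos_of_pos_of_lt_pi hθ.1 (by linarith [hθ.2, pi_pos])
      have hc : 0 < Real.cos θ := Real.cos_pos_of_mem_Ioo ⟨by linarith [hθ.1, pi_pos], hθ.2⟩
      exact ⟨by positivity, by nlinarith [Real.sin_sq_add_cos_sq θ]⟩
    · intro hx
      refine ⟨Real.arcsin √x, ⟨Real.arcsin_pos.2 (Real.sqrt_pos.2 hx.1), ?_⟩, ?_⟩
      · exact Real.arcsin_lt_pi_div_two.2 ((Real.sqrt_lt' one_pos).2 (by simpa using hx.2))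
      · have : √x ≤ 1 := Real.sqrt_le_one.2 hx.2.le
        simp only
        rw [Real.sin_arcsin (by linarith [Real.sqrt_nonneg x]) this, Real.sq_sqrt hx.1.le]
  have hmono : MonotoneOn (fun θ : ℝ => Real.sin θ ^ 2) (Set.Ioo 0 (π / 2)) := by
    intro x hx y hy hxy
    have := Real.strictMonoOn_sin.monotoneOn (a := x) (b := y)
      ⟨by linarith [hx.1, pi_pos], hx.2.le⟩ ⟨by linarith [hy.1, pi_pos], hy.2.le⟩ hxy
    exact pow_le_pow_left₀ (Real.sin_nonneg_of_nonneg_of_le_pi hx.1.le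
      (by linarith [hx.2, pi_pos])) this 2
  have hderiv : ∀ x ∈ Set.Ioo 0 (π / 2), HasDerivWithinAt (fun θ : ℝ => Real.sin θ ^ 2)
      (2 * Real.sin x * Real.cos x) (Set.Ioo 0 (π / 2)) x := by
    intro x _
    simpa using ((Real.hasDerivAt_sin x).fun_pow 2).hasDerivWithinAt
  rw [ProbabilityTheory.lintegral_betaPDF, ← himage,
    lintegral_image_eq_lintegral_deriv_mul_of_monotoneOn measurableSet_Ioo hderiv hmono] at hone
  have hfun : ∀ θ ∈ Set.Ioo 0 (π / 2),
      ENNReal.ofReal (Real.sin θ ^ (2 * a - 1) * Real.cos θ ^ (2 * b - 1)) =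
        ENNReal.ofReal (ProbabilityTheory.beta a b / 2) *
          (ENNReal.ofReal (2 * Real.sin θ * Real.cos θ) *
          ENNReal.ofReal (1 / ProbabilityTheory.beta a b * (Real.sin θ ^ 2) ^ (a - 1) *
            (1 - Real.sin θ ^ 2) ^ (b - 1))) := by
    intro θ hθ
    have hs : 0 < Real.sin θ := Real.sin_pos_of_pos_of_lt_pi hθ.1 (by linarith [hθ.2, pi_pos])
    have hc : 0 < Real.cos θ := Real.cos_pos_of_mem_Ioo ⟨by linarith [hθ.1, pi_pos], hθ.2⟩
    have hpow (x : ℝ) (hx : 0 < x) (p : ℝ) : x ^ (2 * p - 1) = x * (x ^ 2) ^ (p - 1) := by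
      rw [← Real.rpow_natCast_mul hx.le, show 2 * p - 1 = 1 + ((2 : ℕ) : ℝ) * (p - 1) by
        push_cast; ring, Real.rpow_add hx, Real.rpow_one]
    rw [← ENNReal.ofReal_mul (by positivity), ← ENNReal.ofReal_mul (by positivity),
      ← Real.cos_sq', hpow _ hs, hpow _ hc]
    congr 1
    field_simp
  rw [setLIntegral_congr_fun measurableSet_Ioo hfun, lintegral_const_mul, hone, mul_one]
  fun_prop

/-- The integral of `|sin (n θ)| ^ s` over a full turn. -/
lemma lintegral_abs_sin_mul_rpow (n : ℕ) (hn : 0 < n) (s : ℝ) (hs : -1 < s) :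
    ∫⁻ θ in Set.Ioo (-π) π, ENNReal.ofReal (|Real.sin (n * θ)| ^ s) =
      ENNReal.ofReal (2 * ProbabilityTheory.beta ((s + 1) / 2) (1 / 2)) := by
  have hn' : (n : ℝ) ≠ 0 := by exact_mod_cast hn.ne'
  set B := ProbabilityTheory.beta ((s + 1) / 2) (1 / 2) with hBdef
  have hB : 0 < B := ProbabilityTheory.beta_pos (by linarith) (by norm_num)
  set g : ℝ → ℝ := fun θ => |Real.sin θ| ^ s with hg
  have hg0 (θ : ℝ) : 0 ≤ g θ := Real.rpow_nonneg (abs_nonneg _) _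
  have hgm : Measurable g := by fun_prop
  have heven (θ : ℝ) : g θ = g (-θ) := by simp [hg]
  have hper : Function.Periodic g π := fun θ => by simp [hg, Real.sin_add_pi]
  have hquarter : ∫⁻ θ in Set.Ioc 0 (π / 2), ENNReal.ofReal (g θ) = ENNReal.ofReal (B / 2) := by
    rw [← restrict_Ioo_eq_restrict_Ioc,
      ← lintegral_sin_rpow_mul_cos_rpow ((s + 1) / 2) (1 / 2) (by linarith) (by norm_num)]
    refine setLIntegral_congr_fun measurableSet_Ioo fun θ hθ => ?_
    have hs : 0 < Real.sin θ := Real.sin_pos_of_pos_of_lt_pi hθ.1 (by linarith [hθ.2, pi_pos])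
    simp only [hg]
    rw [abs_of_pos hs, show 2 * (1 / 2 : ℝ) - 1 = 0 by norm_num, Real.rpow_zero, mul_one]
    congr 2
    ring
  have hintegrable_right : IntervalIntegrable g volume 0 (π / 2) := by
    rw [intervalIntegrable_iff_integrableOn_Ioc_of_le (by positivity)]
    refine ⟨hgm.aestronglyMeasurable, ?_⟩
    rw [hasFiniteIntegral_iff_ofReal (Filter.Eventually.of_forall hg0), hquarter]
    exact ENNReal.ofReal_lt_top
  have hval : ∫ θ in (0)..(π / 2), g θ = B / 2 := by
    rw [intervalIntegral.integral_of_le (by positivity),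
      integral_eq_lintegral_of_nonneg_ae (Filter.Eventually.of_forall hg0)
        hgm.aestronglyMeasurable, hquarter, ENNReal.toReal_ofReal (by positivity)]
  have hintegrable_left : IntervalIntegrable g volume (-(π / 2)) 0 := by
    have := (IntervalIntegrable.iff_comp_neg (f := g) (a := 0) (b := π / 2)).1 hintegrable_right
    simp only [← heven, neg_zero] at this
    exact this.symm
  have hval' : ∫ θ in (-(π / 2))..0, g θ = B / 2 := by
    have := intervalIntegral.integral_comp_neg (a := 0) (b := π / 2) g
    simp only [← heven, neg_zero] at this
    rw [← this, hval]
  have hall := hper.intervalIntegrable pi_ne_zero (t := -(π / 2))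
    (by convert! hintegrable_left.trans hintegrable_right using 1; ring)
  have hperiod : ∫ θ in (-(n * π))..(-(n * π) + π), g θ = B := by
    rw [hper.intervalIntegral_add_eq _ (-(π / 2)), show -(π / 2) + π = π / 2 by ring,
      ← intervalIntegral.integral_add_adjacent_intervals hintegrable_left hintegrable_right,
      hval, hval']
    ring
  have hfull : ∫ θ in (-π)..π, g (n * θ) = 2 * B := by
    have h := hper.intervalIntegral_add_zsmul_eq (2 * n) (-(n * π)) hall
    rw [hperiod] at h
    rw [intervalIntegral.integral_comp_mul_left _ hn', mul_neg]
    rw [show -(n * π) + (2 * n : ℤ) • π = n * π by simp; ring] at h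
    rw [h]
    simp only [zsmul_eq_mul, smul_eq_mul]
    push_cast
    field_simp
  rw [restrict_Ioo_eq_restrict_Ioc, ← ofReal_integral_eq_lintegral_ofReal,
    ← intervalIntegral.integral_of_le (by linarith [pi_pos])]
  · exact congrArg _ hfull
  · rw [← IntegrableOn, ← intervalIntegrable_iff_integrableOn_Ioc_of_le (by linarith [pi_pos])]
    have := (hall (n * (-π)) (n * π)).comp_mul_left (c := n)
    simpa [hg, hn', neg_div] using this
  · exact Filter.Eventually.of_forall fun θ => hg0 _

theorem area_Fn_star (n : ℕ) (hn : 3 ≤ n) :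
    MeasureTheory.volume
        {p : ℝ × ℝ |
          |∏ k ∈ Finset.Icc 1 n,
              (p.1 * Real.sin (k * π / n) - p.2 * Real.cos (k * π / n))| ≤ 1} =
      ENNReal.ofReal
        ((4 : ℝ) ^ (1 - 1 / n : ℝ) *
          (Real.Gamma (1 / 2 - 1 / n) * Real.Gamma (1 / 2) /
            Real.Gamma (1 / 2 - 1 / n + 1 / 2))) := by
  have hn0 : 0 < n := by lia
  have hnR : (3 : ℝ) ≤ n := by exact_mod_cast hn
  set S := {p : ℝ × ℝ | |∏ k ∈ Finset.Icc 1 n,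
    (p.1 * Real.sin (k * π / n) - p.2 * Real.cos (k * π / n))| ≤ 1} with hS
  have hmeas : MeasurableSet S := measurableSet_le (by fun_prop) measurable_const
  have hpolar (r θ : ℝ) (hr : 0 < r) : polarCoord.symm (r, θ) ∈ S ↔
      r ^ n * (2 * |Real.sin (n * θ)| / 2 ^ n) ≤ 1 := by
    rw [← abs_prod_sin_sub n hn0 θ, hS, Set.mem_ofPred_eq, polarCoord_symm_apply]
    have : ∀ k ∈ Finset.Icc 1 n, r * Real.cos θ * Real.sin (k * π / n) -
        r * Real.sin θ * Real.cos (k * π / n) = r * Real.sin (k * π / n - θ) := by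
      intro k _
      rw [Real.sin_sub]
      ring
    rw [Finset.prod_congr rfl this, Finset.prod_mul_distrib, Finset.prod_const, Nat.card_Icc,
      Nat.add_sub_cancel, abs_mul, abs_of_pos (pow_pos hr n)]
  have hsin : ∀ᵐ θ : ℝ, Real.sin (n * θ) ≠ 0 := by
    refine Set.Countable.ae_notMem ((Set.countable_range fun k : ℤ => k * π / n).mono ?_) volume
    intro θ hθ
    obtain ⟨k, hk⟩ := Real.sin_eq_zero_iff.1 hθ
    exact ⟨k, by simp only [hk]; field_simp⟩
  have hf : Measurable fun p : ℝ × ℝ =>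
      ENNReal.ofReal p.1 * S.indicator 1 (polarCoord.symm p) :=
    (by fun_prop : Measurable fun p : ℝ × ℝ => ENNReal.ofReal p.1).mul
      ((measurable_one.indicator hmeas).comp continuous_polarCoord_symm.measurable)
  have hscale (t : ℝ) (ht : 0 < t) : (2 * t / 2 ^ n) ^ (-(2 / n) : ℝ) / 2 =
      (4 : ℝ) ^ (1 - 1 / n : ℝ) / 2 * t ^ (-(2 / n) : ℝ) := by
    have h : 2 * t / 2 ^ n = (2 : ℝ) ^ (1 - n : ℝ) * t := by
      rw [Real.rpow_sub two_pos, Real.rpow_one, Real.rpow_natCast]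
      ring
    rw [h, Real.mul_rpow (by positivity) ht.le, ← Real.rpow_mul two_pos.le,
      show (4 : ℝ) = 2 ^ (2 : ℝ) by norm_num, ← Real.rpow_mul two_pos.le,
      show (1 - n : ℝ) * -(2 / n) = 2 * (1 - 1 / n) by field_simp; ring]
    ring
  have hs : (-1 : ℝ) < -(2 / n) := by
    rw [neg_lt_neg_iff, div_lt_one (by positivity)]
    linarith
  calc volume S = ∫⁻ p, S.indicator 1 p := (lintegral_indicator_one hmeas).symm
    _ = ∫⁻ p in Set.Ioi (0 : ℝ) ×ˢ Set.Ioo (-π) π,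
        ENNReal.ofReal p.1 * S.indicator 1 (polarCoord.symm p) :=
      (lintegral_comp_polarCoord_symm _).symm
    _ = ∫⁻ θ in Set.Ioo (-π) π, ∫⁻ r in Set.Ioi (0 : ℝ),
        ENNReal.ofReal r * S.indicator 1 (polarCoord.symm (r, θ)) := by
      rw [Measure.volume_eq_prod, ← Measure.prod_restrict, lintegral_prod_symm _ hf.aemeasurable]
    _ = ∫⁻ θ in Set.Ioo (-π) π, ENNReal.ofReal ((4 : ℝ) ^ (1 - 1 / n : ℝ) / 2) *
        ENNReal.ofReal (|Real.sin (n * θ)| ^ (-(2 / n) : ℝ)) := by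
      refine lintegral_congr_ae (ae_restrict_of_ae (hsin.mono fun θ hθ => ?_))
      have hpos : 0 < |Real.sin (n * θ)| := abs_pos.2 hθ
      simp only
      rw [← ENNReal.ofReal_mul (by positivity), ← hscale _ hpos,
        ← lintegral_Ioi_radius n hn0 _ (by positivity)]
      refine setLIntegral_congr_fun measurableSet_Ioi fun r hr => ?_
      simp only [Set.indicator_apply, hpolar r θ hr, Set.mem_ofPred_eq, Pi.one_apply]
    _ = _ := by
      rw [lintegral_const_mul _ (by fun_prop), lintegral_abs_sin_mul_rpow n hn0 _ hs,
        ← ENNReal.ofReal_mul (by positivity), ProbabilityTheory.beta,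
        show (-(2 / n) + 1 : ℝ) / 2 = 1 / 2 - 1 / n by ring]
      congr 1
      ring
end

section
/- For every integer n ≥ 3, the area of the region { (x,y) ∈ ℝ² : |F_n*(x,y)| ≤ 1 } equals (2^(1 − 2/n) / n) · ∫₀^{2πn} |sin θ|^(−2/n) dθ, which in turn equals 4^(1−1/n) · 2 ∫₀^{π/2} (sin θ)^(−2/n) dθ. -/
open Real Finset MeasureTheory intervalIntegral

theorem prod_abs_sin_sub (n : ℕ) (hn : 0 < n) (φ : ℝ) :
    ∏ k ∈ Finset.Icc 1 n, (2 * |Real.sin (k * π / n - φ)|) = 2 * |Real.sin (n * φ)| := by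
  have norm_one_sub (x : ℝ) : ‖1 - Complex.exp (Complex.I * x)‖ = 2 * |Real.sin (x / 2)| := by
    rw [norm_sub_rev, Complex.norm_exp_I_mul_ofReal_sub_one]
    simp
  have hn' : (n : ℂ) ≠ 0 := by exact_mod_cast hn.ne'
  have hα : (Complex.exp (2 * π * Complex.I / n) * Complex.exp (Complex.I * (-2 * φ : ℝ))) ^ n =
      Complex.exp (Complex.I * (-2 * (n * φ) : ℝ)) := by
    rw [mul_pow, (Complex.isPrimitiveRoot_exp n hn.ne').pow_eq_one, one_mul, ← Complex.exp_nat_mul]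
    congr 1
    push_cast
    ring
  have key := congrArg (Polynomial.eval 1)
    (X_pow_sub_C_eq_prod (Complex.isPrimitiveRoot_exp n hn.ne') hn hα)
  simp only [Polynomial.eval_sub, Polynomial.eval_pow, Polynomial.eval_X, Polynomial.eval_C,
    one_pow, Polynomial.eval_prod] at key
  have hnorm := congrArg norm key
  rw [norm_one_sub, norm_prod] at hnorm
  have hhalf : -2 * (n * φ) / 2 = -(n * φ) := by ring
  rw [hhalf, Real.sin_neg, abs_neg] at hnorm
  rw [hnorm, ← Finset.Ico_add_one_right_eq_Icc, Finset.prod_Ico_eq_prod_range]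
  refine Finset.prod_congr (by simp) fun k _ => ?_
  have hexp : Complex.exp (2 * π * Complex.I / n) ^ k *
      (Complex.exp (2 * π * Complex.I / n) * Complex.exp (Complex.I * (-2 * φ : ℝ))) =
      Complex.exp (Complex.I * (2 * (((1 + k : ℕ) : ℝ) * π / n - φ) : ℝ)) := by
    rw [← Complex.exp_nat_mul, ← Complex.exp_add, ← Complex.exp_add]
    congr 1
    push_cast
    field_simp
    ring
  rw [hexp, norm_one_sub]
  congr 3
  ring

theorem abs_prod_polar (n : ℕ) (hn : 0 < n) (r φ : ℝ) (hr : 0 < r) :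
    |∏ k ∈ Finset.Icc 1 n, (r * Real.cos φ * Real.sin (k * π / n) -
      r * Real.sin φ * Real.cos (k * π / n))| = 2 * (r / 2) ^ n * |Real.sin (n * φ)| := by
  have h (k : ℕ) : |r * Real.cos φ * Real.sin (k * π / n) -
      r * Real.sin φ * Real.cos (k * π / n)| = r / 2 * (2 * |Real.sin (k * π / n - φ)|) := by
    rw [Real.sin_sub, show r * Real.cos φ * Real.sin (k * π / n) -
      r * Real.sin φ * Real.cos (k * π / n) = r * (Real.sin (k * π / n) * Real.cos φ -
      Real.cos (k * π / n) * Real.sin φ) by ring, abs_mul, abs_of_pos hr]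
    ring
  rw [Finset.abs_prod, Finset.prod_congr rfl fun k _ => h k, Finset.prod_mul_distrib,
    prod_abs_sin_sub n hn]
  simp only [Finset.prod_const, Nat.card_Icc, add_tsub_cancel_right]
  ring

theorem periodic_abs_sin_rpow (s : ℝ) : Function.Periodic (fun θ => |Real.sin θ| ^ s) π :=
  fun θ => by simp [Real.sin_add_pi]

theorem intervalIntegrable_abs_sin_rpow {s : ℝ} (hs : -1 < s) (hs0 : s ≤ 0) (a b : ℝ) :
    IntervalIntegrable (fun θ => |Real.sin θ| ^ s) volume a b := by
  have hpi := Real.pi_pos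
  have hpos : IntervalIntegrable (fun θ => |Real.sin θ| ^ s) volume 0 (π / 2) := by
    refine ((intervalIntegrable_rpow' hs).const_mul ((2 / π) ^ s)).mono_fun'
      (Real.continuous_sin.abs.measurable.pow_const s).aestronglyMeasurable ?_
    refine (ae_restrict_iff' measurableSet_uIoc).2 (ae_of_all _ fun θ hθ => ?_)
    rw [Set.uIoc_of_le (by positivity)] at hθ
    have hlow := Real.mul_le_sin hθ.1.le hθ.2
    have hpos' : 0 < 2 / π * θ := mul_pos (by positivity) hθ.1
    dsimp only
    rw [Real.norm_of_nonneg (by positivity), ← Real.mul_rpow (by positivity) hθ.1.le,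
      abs_of_pos (hpos'.trans_le hlow)]
    exact Real.rpow_le_rpow_of_nonpos hpos' hlow hs0
  have hneg : IntervalIntegrable (fun θ => |Real.sin θ| ^ s) volume (-(π / 2)) 0 := by
    rw [IntervalIntegrable.iff_comp_neg]
    simpa using hpos.symm
  refine (periodic_abs_sin_rpow s).intervalIntegrable hpi.ne' (t := -(π / 2)) ?_ a b
  convert hneg.trans hpos using 1
  ring

theorem integral_abs_sin_rpow_add_nat_mul_pi {s : ℝ} (hs : -1 < s) (hs0 : s ≤ 0) (t : ℝ) (m : ℕ) :
    ∫ θ in t..(t + m * π), |Real.sin θ| ^ s = 2 * m * ∫ θ in (0 : ℝ)..(π / 2), Real.sin θ ^ s := by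
  have hi := intervalIntegrable_abs_sin_rpow hs hs0
  have hper := (periodic_abs_sin_rpow s).intervalIntegral_add_zsmul_eq m t hi
  have habs : ∫ θ in (0 : ℝ)..(π / 2), |Real.sin θ| ^ s =
      ∫ θ in (0 : ℝ)..(π / 2), Real.sin θ ^ s := by
    refine intervalIntegral.integral_congr fun θ hθ => ?_
    rw [Set.uIcc_of_le (by positivity)] at hθ
    rw [abs_of_nonneg (Real.sin_nonneg_of_nonneg_of_le_pi hθ.1 (by linarith [hθ.2, Real.pi_pos]))]
  have hneg : ∫ θ in (-(π / 2))..0, |Real.sin θ| ^ s =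
      ∫ θ in (0 : ℝ)..(π / 2), |Real.sin θ| ^ s := by
    have := intervalIntegral.integral_comp_neg (a := 0) (b := π / 2) fun θ => |Real.sin θ| ^ s
    simpa using this.symm
  rw [(periodic_abs_sin_rpow s).intervalIntegral_add_eq t (-(π / 2)),
    show -(π / 2) + π = π / 2 by ring,
    ← intervalIntegral.integral_add_adjacent_intervals (hi (-(π / 2)) 0) (hi 0 (π / 2)),
    hneg, habs] at hper
  simp only [zsmul_eq_mul, Int.cast_natCast] at hper
  rw [hper]
  ring

theorem lintegral_indicator_Iic_radius {R : ℝ} (hR : 0 ≤ R) :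
    ∫⁻ r in Set.Ioi (0 : ℝ), ENNReal.ofReal r * (Set.Iic R).indicator 1 r =
      ENNReal.ofReal (R ^ 2 / 2) := by
  have h (r : ℝ) : ENNReal.ofReal r * (Set.Iic R).indicator 1 r =
      (Set.Iic R).indicator (fun r => ENNReal.ofReal r) r := by
    by_cases hr : r ∈ Set.Iic R <;> simp [hr]
  simp_rw [h]
  rw [setLIntegral_indicator measurableSet_Iic, Set.inter_comm, Set.Ioi_inter_Iic,
    ← ofReal_integral_eq_lintegral_ofReal, ← intervalIntegral.integral_of_le hR, integral_id]
  · simp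
  · exact (intervalIntegrable_iff_integrableOn_Ioc_of_le hR).1 intervalIntegrable_id
  · exact (ae_restrict_iff' measurableSet_Ioc).2 (ae_of_all _ fun r hr => hr.1.le)

theorem two_mul_half_pow_mul_le_one_iff {n : ℕ} (hn : 0 < n) {r c : ℝ} (hr : 0 < r) (hc : 0 < c) :
    2 * (r / 2) ^ n * c ≤ 1 ↔ r ≤ 2 * (2 * c) ^ (-(1 / n) : ℝ) := by
  have hn' : (n : ℝ) ≠ 0 := by exact_mod_cast hn.ne'
  have hp : ((2 * c) ^ (-(1 / n) : ℝ)) ^ n = (2 * c)⁻¹ := by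
    rw [← Real.rpow_natCast, ← Real.rpow_mul (by positivity),
      show -(1 / (n : ℝ)) * n = -1 by field_simp, Real.rpow_neg_one]
  rw [← div_le_iff₀' two_pos, ← pow_le_pow_iff_left₀ (a := r / 2) (by positivity) (by positivity) hn.ne', hp,
    ← one_div, le_div_iff₀ (by positivity)]
  ring_nf

theorem ae_sin_nat_mul_ne_zero {n : ℕ} (hn : 0 < n) : ∀ᵐ φ : ℝ, Real.sin (n * φ) ≠ 0 := by
  have hn' : (n : ℝ) ≠ 0 := by exact_mod_cast hn.ne'
  refine ((Set.countable_range fun m : ℤ => m * π / n).mono ?_).measure_zero volume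
  intro φ hφ
  obtain ⟨m, hm⟩ := Real.sin_eq_zero_iff.1 (not_not.1 hφ)
  exact ⟨m, by simp only [hm]; field_simp⟩

theorem volume_abs_prod_le_one (n : ℕ) (hn : 0 < n) :
    volume {p : ℝ × ℝ | |∏ k ∈ Finset.Icc 1 n,
        (p.1 * Real.sin (k * π / n) - p.2 * Real.cos (k * π / n))| ≤ 1} =
      ∫⁻ φ in Set.Ioo (-π) π, ENNReal.ofReal
        ((2 : ℝ) ^ (1 - 2 / n : ℝ) * |Real.sin (n * φ)| ^ (-(2 / n) : ℝ)) := by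
  set S := {p : ℝ × ℝ | |∏ k ∈ Finset.Icc 1 n,
        (p.1 * Real.sin (k * π / n) - p.2 * Real.cos (k * π / n))| ≤ 1}
  have hSm : MeasurableSet S := measurableSet_le (by fun_prop) measurable_const
  rw [← lintegral_indicator_one hSm, ← lintegral_comp_polarCoord_symm]
  simp only [polarCoord_target, smul_eq_mul]
  rw [Measure.volume_eq_prod, ← Measure.prod_restrict, lintegral_prod_symm]
  swap
  · have hp : Measurable fun p : ℝ × ℝ => polarCoord.symm p := by
      simp only [polarCoord_symm_apply]
      fun_prop
    exact ((ENNReal.measurable_ofReal.comp measurable_fst).mul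
      ((measurable_one.indicator hSm).comp hp)).aemeasurable
  refine lintegral_congr_ae ?_
  filter_upwards [ae_restrict_of_ae (ae_sin_nat_mul_ne_zero hn)] with φ hφ
  have hc : 0 < |Real.sin (n * φ)| := abs_pos.2 hφ
  have hR : (2 * (2 * |Real.sin (n * φ)|) ^ (-(1 / n) : ℝ)) ^ 2 / 2 =
      (2 : ℝ) ^ (1 - 2 / n : ℝ) * |Real.sin (n * φ)| ^ (-(2 / n) : ℝ) := by
    rw [mul_pow, ← Real.rpow_natCast (_ ^ _), ← Real.rpow_mul (by positivity),
      show -(1 / (n : ℝ)) * (2 : ℕ) = -(2 / n) by push_cast; ring,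
      Real.mul_rpow two_pos.le hc.le, sub_eq_add_neg, Real.rpow_add two_pos, Real.rpow_one]
    ring
  rw [← hR, ← lintegral_indicator_Iic_radius (by positivity)]
  refine setLIntegral_congr_fun measurableSet_Ioi fun r hr => ?_
  have hmem : polarCoord.symm (r, φ) ∈ S ↔
      r ∈ Set.Iic (2 * (2 * |Real.sin (n * φ)|) ^ (-(1 / n) : ℝ)) := by
    rw [Set.mem_Iic, ← two_mul_half_pow_mul_le_one_iff hn hr hc, ← abs_prod_polar n hn r φ hr]
    rfl
  simp only [Set.indicator_apply, hmem, Pi.one_apply]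

theorem area_Fn_star_integral (n : ℕ) (hn : 3 ≤ n) :
    MeasureTheory.volume
        {p : ℝ × ℝ |
          |∏ k ∈ Finset.Icc 1 n,
              (p.1 * Real.sin (k * π / n) - p.2 * Real.cos (k * π / n))| ≤ 1} =
      ENNReal.ofReal
        ((2 : ℝ) ^ (1 - 2 / n : ℝ) / n *
          ∫ θ in (0 : ℝ)..(2 * π * n), |Real.sin θ| ^ (-(2 / n) : ℝ)) ∧
    (2 : ℝ) ^ (1 - 2 / n : ℝ) / n *
        (∫ θ in (0 : ℝ)..(2 * π * n), |Real.sin θ| ^ (-(2 / n) : ℝ)) =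
      (4 : ℝ) ^ (1 - 1 / n : ℝ) *
        (2 * ∫ θ in (0 : ℝ)..(π / 2), Real.sin θ ^ (-(2 / n) : ℝ)) := by
  have hn0 : 0 < n := by lia
  have hnR : (3 : ℝ) ≤ n := by exact_mod_cast hn
  have hs : -1 < (-(2 / n) : ℝ) := by
    rw [neg_lt_neg_iff, div_lt_one (by positivity)]
    linarith
  have hs0 : (-(2 / n) : ℝ) ≤ 0 := neg_nonpos.2 (by positivity)
  have hper := integral_abs_sin_rpow_add_nat_mul_pi hs hs0
  have hfull : ∫ θ in (0 : ℝ)..(2 * π * n), |Real.sin θ| ^ (-(2 / n) : ℝ) =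
      2 * (2 * n : ℕ) * ∫ θ in (0 : ℝ)..(π / 2), Real.sin θ ^ (-(2 / n) : ℝ) := by
    rw [← hper 0 (2 * n)]
    congr 1
    push_cast
    ring
  constructor
  · have hle : -π ≤ π := by linarith [Real.pi_pos]
    have hi : IntervalIntegrable
        (fun φ => (2 : ℝ) ^ (1 - 2 / n : ℝ) * |Real.sin (n * φ)| ^ (-(2 / n) : ℝ))
        volume (-π) π := by
      have := (intervalIntegrable_abs_sin_rpow hs hs0 (n * -π) (n * π)).comp_mul_left (c := n)
      rw [mul_div_cancel_left₀ _ (by positivity), mul_div_cancel_left₀ _ (by positivity)] at this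
      exact this.const_mul _
    rw [volume_abs_prod_le_one n hn0, restrict_Ioo_eq_restrict_Ioc,
      ← ofReal_integral_eq_lintegral_ofReal
        ((intervalIntegrable_iff_integrableOn_Ioc_of_le hle).1 hi)
        (ae_of_all _ fun φ => by positivity),
      ← intervalIntegral.integral_of_le hle, intervalIntegral.integral_const_mul,
      intervalIntegral.integral_comp_mul_left (fun θ => |Real.sin θ| ^ (-(2 / n) : ℝ))
        (by positivity),
      show (n : ℝ) * π = n * -π + (2 * n : ℕ) * π by push_cast; ring, hper, hfull, smul_eq_mul]
    congr 1
    ring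
  · have h4 : (4 : ℝ) ^ (1 - 1 / n : ℝ) = 2 * 2 ^ (1 - 2 / n : ℝ) := by
      rw [show (4 : ℝ) = 2 ^ (2 : ℝ) by norm_num, ← Real.rpow_mul two_pos.le,
        show (2 : ℝ) * (1 - 1 / n) = 1 + (1 - 2 / n) by ring, Real.rpow_add two_pos, Real.rpow_one]
    rw [hfull, h4]
    push_cast
    field_simp
end
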